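/- Under Assumption 1, let K̂ ∈ 𝒦 have spectral radius of A + BK̂ strictly less than 1, and define the sequences h_up_0 = (I − (A + BK̂))^{−T}(s + K̂^T r), h_up_{k+1} = T(h_up_k), and h_low_0 = 0, h_low_{k+1} = T(h_low_k). Then the upper sequence is entrywise nonincreasing, h_up_0 ≥ h_up_1 ≥ h_up_2 ≥ …, the lower sequence is entrywise nondecreasing with h_low_1 = s, i.e. 0 = h_low_0 ≤ s = h_low_1 ≤ h_low_2 ≤ …, and in each of these inequalities the two vectors differ in at least one entry unless the corresponding iterate is a fixed point of T. -/

import Mathlib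

open Matrix Finset

/-- `minZero v` is the minimum of the entries of `v` and of the scalar `0`. -/
noncomputable def minZero {k : ℕ} (v : Fin k → ℝ) : ℝ :=
  (insert (0 : ℝ) (Finset.image v Finset.univ)).min' (Finset.insert_nonempty _ _)

/-- The Bellman operator `T(p) = s + Aᵀ p + Σ_i min{r_i + B_iᵀ p, 0} E_i`. -/
noncomputable def bellman {n : ℕ} {m : Fin n → ℕ}
    (A : Matrix (Fin n) (Fin n) ℝ) (B : ∀ i, Matrix (Fin n) (Fin (m i)) ℝ)
    (s : Fin n → ℝ) (r : ∀ i, Fin (m i) → ℝ) (E : Matrix (Fin n) (Fin n) ℝ)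
    (p : Fin n → ℝ) : Fin n → ℝ :=
  fun j => s j + (Aᵀ *ᵥ p) j +
    ∑ i, minZero (fun l => r i l + ((B i)ᵀ *ᵥ p) l) * E i j

/-- Membership in the set 𝒦 of blockwise nonnegative feedback matrices with
full (`1ᵀ K_i = E_iᵀ`) or zero (`1ᵀ K_i = 0`) actuation in each block. -/
def memK {n : ℕ} {m : Fin n → ℕ} (E : Matrix (Fin n) (Fin n) ℝ)
    (K : ∀ i, Matrix (Fin (m i)) (Fin n) ℝ) : Prop :=
  ∀ i, (∀ l j, 0 ≤ K i l j) ∧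
    ((∀ j, ∑ l, K i l j = E i j) ∨ (∀ j, ∑ l, K i l j = 0))

/-- Assumption 1: `(A + BK) x ≥ 0` for every `K ∈ 𝒦` and every `x ≥ 0`. -/
def assumption1 {n : ℕ} {m : Fin n → ℕ}
    (A : Matrix (Fin n) (Fin n) ℝ) (B : ∀ i, Matrix (Fin n) (Fin (m i)) ℝ)
    (E : Matrix (Fin n) (Fin n) ℝ) : Prop :=
  ∀ K : ∀ i, Matrix (Fin (m i)) (Fin n) ℝ, memK E K →
    ∀ x : Fin n → ℝ, 0 ≤ x → 0 ≤ (A + ∑ i, B i * K i) *ᵥ x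

/-- The constraint set `U(x) = {u : u ≥ 0, 1ᵀ u_i ≤ E_iᵀ x for all i}`. -/
def inputSet {n : ℕ} {m : Fin n → ℕ} (E : Matrix (Fin n) (Fin n) ℝ)
    (x : Fin n → ℝ) : Set (∀ i, Fin (m i) → ℝ) :=
  {u | ∀ i, (∀ l, 0 ≤ u i l) ∧ (∑ l, u i l) ≤ ∑ j, E i j * x j}

/-- An admissible trajectory from `x0`: `x(0) = x0`, `u(t) ∈ U(x(t))` and
`x(t+1) = A x(t) + B u(t)`. -/
def admissible {n : ℕ} {m : Fin n → ℕ}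
    (A : Matrix (Fin n) (Fin n) ℝ) (B : ∀ i, Matrix (Fin n) (Fin (m i)) ℝ)
    (E : Matrix (Fin n) (Fin n) ℝ) (x0 : Fin n → ℝ)
    (x : ℕ → Fin n → ℝ) (u : ℕ → ∀ i, Fin (m i) → ℝ) : Prop :=
  x 0 = x0 ∧ ∀ t, u t ∈ inputSet E (x t) ∧
    x (t + 1) = A *ᵥ x t + ∑ i, (B i) *ᵥ (u t i)

/-- The state trajectory generated by a control sequence `u` from `x0`. -/
noncomputable def traj {n : ℕ} {m : Fin n → ℕ}
    (A : Matrix (Fin n) (Fin n) ℝ) (B : ∀ i, Matrix (Fin n) (Fin (m i)) ℝ)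
    (x0 : Fin n → ℝ) (u : ℕ → ∀ i, Fin (m i) → ℝ) : ℕ → Fin n → ℝ
  | 0 => x0
  | t + 1 => A *ᵥ traj A B x0 u t + ∑ i, (B i) *ᵥ (u t i)

/-- Total cost `Σ_{t=0}^∞ [sᵀ x(t) + rᵀ u(t)] ∈ [0,∞]` of a trajectory. -/
noncomputable def trajCost {n : ℕ} {m : Fin n → ℕ}
    (s : Fin n → ℝ) (r : ∀ i, Fin (m i) → ℝ)
    (x : ℕ → Fin n → ℝ) (u : ℕ → ∀ i, Fin (m i) → ℝ) : ENNReal :=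
  ∑' t, ENNReal.ofReal ((∑ j, s j * x t j) + ∑ i, ∑ l, r i l * u t i l)

/-- Optimal value `V(x0)`: infimum of the total cost over admissible trajectories. -/
noncomputable def optValue {n : ℕ} {m : Fin n → ℕ}
    (A : Matrix (Fin n) (Fin n) ℝ) (B : ∀ i, Matrix (Fin n) (Fin (m i)) ℝ)
    (E : Matrix (Fin n) (Fin n) ℝ) (s : Fin n → ℝ) (r : ∀ i, Fin (m i) → ℝ)
    (x0 : Fin n → ℝ) : ENNReal :=
  ⨅ (x : ℕ → Fin n → ℝ) (u : ℕ → ∀ i, Fin (m i) → ℝ)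
    (_ : admissible A B E x0 x u), trajCost s r x u

/-- The spectral radius of `M` is strictly less than `1`. -/
def schurStable {n : ℕ} (M : Matrix (Fin n) (Fin n) ℝ) : Prop :=
  ∀ μ ∈ spectrum ℂ (M.map Complex.ofReal), ‖μ‖ < 1

theorem minZero_nonpos {k : ℕ} (v : Fin k → ℝ) : minZero v ≤ 0 :=
  Finset.min'_le _ _ (Finset.mem_insert_self _ _)

theorem minZero_le {k : ℕ} (v : Fin k → ℝ) (l : Fin k) : minZero v ≤ v l :=
  Finset.min'_le _ _ (Finset.mem_insert_of_mem (Finset.mem_image_of_mem v (Finset.mem_univ l)))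

theorem minZero_eq_zero_or_exists {k : ℕ} (v : Fin k → ℝ) :
    minZero v = 0 ∨ ∃ l, v l = minZero v := by
  have h := Finset.min'_mem (insert (0 : ℝ) (Finset.image v Finset.univ))
    (Finset.insert_nonempty _ _)
  rcases Finset.mem_insert.mp h with h | h
  · exact Or.inl h
  · obtain ⟨l, -, hl⟩ := Finset.mem_image.mp h
    exact Or.inr ⟨l, hl⟩

theorem minZero_eq_zero {k : ℕ} {v : Fin k → ℝ} (hv : ∀ l, 0 ≤ v l) : minZero v = 0 := by
  rcases minZero_eq_zero_or_exists v with h | ⟨l, hl⟩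
  · exact h
  · exact le_antisymm (minZero_nonpos v) (hl ▸ hv l)

/-- The affine operator `p ↦ s + (A + BK)ᵀ p + Kᵀ r` of the fixed feedback `K`. -/
noncomputable def policyOp {n : ℕ} {m : Fin n → ℕ}
    (A : Matrix (Fin n) (Fin n) ℝ) (B : ∀ i, Matrix (Fin n) (Fin (m i)) ℝ)
    (s : Fin n → ℝ) (r : ∀ i, Fin (m i) → ℝ) (K : ∀ i, Matrix (Fin (m i)) (Fin n) ℝ)
    (p : Fin n → ℝ) : Fin n → ℝ :=
  (A + ∑ i, B i * K i)ᵀ *ᵥ p + (s + ∑ i, (K i)ᵀ *ᵥ r i)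

section

variable {n : ℕ} {m : Fin n → ℕ}
  {A : Matrix (Fin n) (Fin n) ℝ} {B : ∀ i, Matrix (Fin n) (Fin (m i)) ℝ}
  {s : Fin n → ℝ} {r : ∀ i, Fin (m i) → ℝ} {E : Matrix (Fin n) (Fin n) ℝ}

theorem policyOp_apply (K : ∀ i, Matrix (Fin (m i)) (Fin n) ℝ) (p : Fin n → ℝ) (j : Fin n) :
    policyOp A B s r K p j =
      s j + (Aᵀ *ᵥ p) j + ∑ i, ∑ l, K i l j * (r i l + ((B i)ᵀ *ᵥ p) l) := by
  have h : ∀ i, ∑ l, K i l j * (r i l + ((B i)ᵀ *ᵥ p) l) =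
      ((K i)ᵀ *ᵥ r i) j + ((K i)ᵀ *ᵥ ((B i)ᵀ *ᵥ p)) j := fun i => by
    simp only [mul_add, Finset.sum_add_distrib]
    rfl
  simp only [h, Finset.sum_add_distrib, policyOp, Matrix.transpose_add, Matrix.transpose_sum,
    Matrix.transpose_mul, Matrix.add_mulVec, Matrix.sum_mulVec, Pi.add_apply, Finset.sum_apply,
    Matrix.mulVec_mulVec]
  ring

theorem bellman_le_policyOp (hE : ∀ i j, 0 ≤ E i j)
    {K : ∀ i, Matrix (Fin (m i)) (Fin n) ℝ} (hK : memK E K) (p : Fin n → ℝ) :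
    bellman A B s r E p ≤ policyOp A B s r K p := by
  intro j
  rw [policyOp_apply]
  refine add_le_add_right (Finset.sum_le_sum fun i _ => ?_) _
  set v : Fin (m i) → ℝ := fun l => r i l + ((B i)ᵀ *ᵥ p) l
  obtain ⟨hnonneg, hsum⟩ := hK i
  calc minZero v * E i j ≤ minZero v * ∑ l, K i l j := by
        refine mul_le_mul_of_nonpos_left ?_ (minZero_nonpos v)
        rcases hsum with h | h
        · exact (h j).le
        · exact (h j).trans_le (hE i j)
    _ = ∑ l, K i l j * minZero v := by rw [mul_comm, Finset.sum_mul]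
    _ ≤ ∑ l, K i l j * v l :=
        Finset.sum_le_sum fun l _ => mul_le_mul_of_nonneg_left (minZero_le v l) (hnonneg l j)

theorem exists_memK_policyOp_eq_bellman (hE : ∀ i j, 0 ≤ E i j) (p : Fin n → ℝ) :
    ∃ K : ∀ i, Matrix (Fin (m i)) (Fin n) ℝ,
      memK E K ∧ policyOp A B s r K p = bellman A B s r E p := by
  have key : ∀ i, ∃ Ki : Matrix (Fin (m i)) (Fin n) ℝ,
      ((∀ l j, 0 ≤ Ki l j) ∧ ((∀ j, ∑ l, Ki l j = E i j) ∨ (∀ j, ∑ l, Ki l j = 0))) ∧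
      ∀ j, ∑ l, Ki l j * (r i l + ((B i)ᵀ *ᵥ p) l) =
        minZero (fun l => r i l + ((B i)ᵀ *ᵥ p) l) * E i j := by
    intro i
    rcases minZero_eq_zero_or_exists (fun l => r i l + ((B i)ᵀ *ᵥ p) l) with h | ⟨l₀, h⟩
    · exact ⟨0, ⟨fun _ _ => le_rfl, Or.inr fun j => by simp⟩, fun j => by simp [h]⟩
    · refine ⟨fun l j => if l = l₀ then E i j else 0, ⟨fun l j => ?_, Or.inl fun j => ?_⟩,
        fun j => ?_⟩
      · dsimp only
        split_ifs
        exacts [hE i j, le_rfl]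
      · simp
      · rw [← h]
        simp [mul_comm]
  choose K hK hval using key
  refine ⟨K, hK, funext fun j => ?_⟩
  rw [policyOp_apply]
  exact congrArg _ (Finset.sum_congr rfl fun i _ => hval i j)

theorem policyOp_mono (hA1 : assumption1 A B E)
    {K : ∀ i, Matrix (Fin (m i)) (Fin n) ℝ} (hK : memK E K) :
    Monotone (policyOp A B s r K) := by
  have hnonneg : ∀ i j, 0 ≤ (A + ∑ i, B i * K i) i j := fun i j => by
    have h := hA1 K hK (Pi.single j 1) (Pi.single_nonneg.mpr zero_le_one) i
    rwa [Matrix.mulVec_single_one] at h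
  intro p q hpq j
  have h : ((A + ∑ i, B i * K i)ᵀ *ᵥ p) j ≤ ((A + ∑ i, B i * K i)ᵀ *ᵥ q) j := by
    simp only [Matrix.mulVec, dotProduct, Matrix.transpose_apply]
    exact Finset.sum_le_sum fun i _ => mul_le_mul_of_nonneg_left (hpq i) (hnonneg i j)
  exact add_le_add_left h _

theorem bellman_mono (hE : ∀ i j, 0 ≤ E i j) (hA1 : assumption1 A B E) :
    Monotone (bellman A B s r E) := by
  intro p q hpq
  obtain ⟨K, hK, hq⟩ :=
    exists_memK_policyOp_eq_bellman (A := A) (B := B) (s := s) (r := r) hE q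
  rw [← hq]
  exact (bellman_le_policyOp hE hK p).trans (policyOp_mono hA1 hK hpq)

theorem bellman_zero (hr : ∀ i l, 0 ≤ r i l) : bellman A B s r E 0 = s := by
  funext j
  have h : ∀ i, minZero (fun l => r i l) = 0 := fun i => minZero_eq_zero (hr i)
  simp [bellman, h]

end

theorem schurStable.isUnit_one_sub {n : ℕ} {M : Matrix (Fin n) (Fin n) ℝ} (h : schurStable M) :
    IsUnit (1 - M) := by
  have h1 : (1 : ℂ) ∉ spectrum ℂ (M.map Complex.ofReal) := fun h1 => by
    simpa using h 1 h1
  rw [spectrum.notMem_iff, map_one, Matrix.isUnit_iff_isUnit_det] at h1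
  rw [Matrix.isUnit_iff_isUnit_det, isUnit_iff_ne_zero]
  intro h0
  refine h1.ne_zero ?_
  have : (1 : Matrix (Fin n) (Fin n) ℂ) - M.map Complex.ofReal =
      Complex.ofRealHom.mapMatrix (1 - M) := by
    rw [map_sub, map_one]
    rfl
  rw [this, ← RingHom.map_det, h0, map_zero]

/-- The solution of the affine fixed-point equation of a stabilizing feedback. -/
theorem policyOp_eq_self {n : ℕ} {m : Fin n → ℕ}
    {A : Matrix (Fin n) (Fin n) ℝ} {B : ∀ i, Matrix (Fin n) (Fin (m i)) ℝ}
    {s : Fin n → ℝ} {r : ∀ i, Fin (m i) → ℝ} {K : ∀ i, Matrix (Fin (m i)) (Fin n) ℝ}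
    (hschur : schurStable (A + ∑ i, B i * K i)) {h : Fin n → ℝ}
    (hdef : h = ((1 - (A + ∑ i, B i * K i))⁻¹)ᵀ *ᵥ (s + ∑ i, (K i)ᵀ *ᵥ (r i))) :
    policyOp A B s r K h = h := by
  have hdet := (Matrix.isUnit_iff_isUnit_det _).mp hschur.isUnit_one_sub
  rw [policyOp]
  set M := A + ∑ i, B i * K i
  set c := s + ∑ i, (K i)ᵀ *ᵥ (r i)
  have hc : (1 - M)ᵀ *ᵥ h = c := by
    rw [hdef, Matrix.mulVec_mulVec, ← Matrix.transpose_mul, Matrix.nonsing_inv_mul _ hdet,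
      Matrix.transpose_one, Matrix.one_mulVec]
  rw [← hc, Matrix.transpose_sub, Matrix.transpose_one, Matrix.sub_mulVec, Matrix.one_mulVec]
  abel

theorem exists_lt_of_le_of_ne {ι : Type*} {a b : ι → ℝ} (h : a ≤ b) (hne : a ≠ b) :
    ∃ j, a j < b j :=
  (Pi.lt_def.mp (lt_of_le_of_ne h hne)).2

/-- under Assumption 1, the Value Iteration sequences started from
`h_up_0 = (I − (A + BK̂))^{-T}(s + K̂ᵀ r)` and `h_low_0 = 0` are respectively
entrywise nonincreasing and nondecreasing, with `h_low_1 = s`; each inequality is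
strict in at least one entry unless the corresponding iterate is a fixed point. -/
theorem stmt_14 {n : ℕ} {m : Fin n → ℕ}
    (A : Matrix (Fin n) (Fin n) ℝ) (B : ∀ i, Matrix (Fin n) (Fin (m i)) ℝ)
    (s : Fin n → ℝ) (r : ∀ i, Fin (m i) → ℝ) (E : Matrix (Fin n) (Fin n) ℝ)
    (hs : ∀ j, 0 < s j) (hr : ∀ i l, 0 ≤ r i l)
    (hE : ∀ i j, 0 ≤ E i j) (hEinv : IsUnit E.det)
    (hA1 : assumption1 A B E)
    (K : ∀ i, Matrix (Fin (m i)) (Fin n) ℝ) (hK : memK E K)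
    (hschur : schurStable (A + ∑ i, B i * K i))
    (hup0 : Fin n → ℝ)
    (hdef : hup0 = ((1 - (A + ∑ i, B i * K i))⁻¹)ᵀ *ᵥ (s + ∑ i, (K i)ᵀ *ᵥ (r i))) :
    (∀ k, (bellman A B s r E)^[k + 1] hup0 ≤ (bellman A B s r E)^[k] hup0) ∧
    ((bellman A B s r E)^[1] (0 : Fin n → ℝ) = s) ∧
    (∀ k, (bellman A B s r E)^[k] (0 : Fin n → ℝ) ≤
      (bellman A B s r E)^[k + 1] (0 : Fin n → ℝ)) ∧
    (∀ k, (bellman A B s r E)^[k] hup0 ≠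
        bellman A B s r E ((bellman A B s r E)^[k] hup0) →
      ∃ j, ((bellman A B s r E)^[k + 1] hup0) j < ((bellman A B s r E)^[k] hup0) j) ∧
    (∀ k, (bellman A B s r E)^[k] (0 : Fin n → ℝ) ≠
        bellman A B s r E ((bellman A B s r E)^[k] (0 : Fin n → ℝ)) →
      ∃ j, ((bellman A B s r E)^[k] (0 : Fin n → ℝ)) j <
        ((bellman A B s r E)^[k + 1] (0 : Fin n → ℝ)) j) := by
  have hmono : Monotone (bellman A B s r E) := bellman_mono hE hA1
  have hup : bellman A B s r E hup0 ≤ hup0 :=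
    (bellman_le_policyOp hE hK hup0).trans_eq (policyOp_eq_self hschur hdef)
  have hlow : 0 ≤ bellman A B s r E 0 := by
    rw [bellman_zero hr]
    exact fun j => (hs j).le
  have hanti : ∀ k, (bellman A B s r E)^[k + 1] hup0 ≤ (bellman A B s r E)^[k] hup0 :=
    fun k => hmono.iterate k hup
  have hinc : ∀ k, (bellman A B s r E)^[k] (0 : Fin n → ℝ) ≤
      (bellman A B s r E)^[k + 1] (0 : Fin n → ℝ) :=
    fun k => hmono.iterate k hlow
  refine ⟨hanti, bellman_zero hr, hinc, fun k hne => ?_, fun k hne => ?_⟩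
  · rw [← Function.iterate_succ_apply' (bellman A B s r E)] at hne
    exact exists_lt_of_le_of_ne (hanti k) hne.symm
  · rw [← Function.iterate_succ_apply' (bellman A B s r E)] at hne
    exact exists_lt_of_le_of_ne (hinc k) hne
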